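/- arXiv:2510.15008 — 2 statements merged into one kernel-verified Lean document; each statement's English description precedes it below -/
import Mathlib

section
/- ∫_0^{π/2} x^2 csc^2(x) ln^2(cos(x)) dx = (π/8)ζ(3) + (π^3/6) ln(2) + (π/3) ln^3(2). -/
open Real

/-- Riemann zeta value at a positive integer `m > 1`, as the series `∑ 1/n^m`. -/
noncomputable def zetaVal (m : ℕ) : ℝ := ∑' n : ℕ, 1 / (n + 1 : ℝ) ^ m

/-- Polylogarithm `Li_m(z) = ∑_{k≥1} z^k / k^m`. -/
noncomputable def polyLog (m : ℕ) (z : ℝ) : ℝ := ∑' k : ℕ, z ^ (k + 1) / (k + 1 : ℝ) ^ m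

/-- Generalized harmonic number `H_k^{(m)} = ∑_{n=1}^k 1/n^m`. -/
noncomputable def genHarmonic (k m : ℕ) : ℝ := ∑ n ∈ Finset.range k, 1 / (n + 1 : ℝ) ^ m


lemma aux_U (n : ℕ) : ∃ U : ℝ → ℝ, Continuous U ∧ ∀ u, sin (n * u) = U u * sin u := by
  induction n with
  | zero => exact ⟨fun _ => 0, continuous_const, by simp⟩
  | succ n ih =>
    obtain ⟨U, hU, h⟩ := ih
    refine ⟨fun u => U u * cos u + cos (n * u), by fun_prop, fun u => ?_⟩
    have : ((n + 1 : ℕ) : ℝ) * u = n * u + u := by push_cast; ring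
    rw [this, sin_add, h]; ring

noncomputable def DD (n : ℕ) (u : ℝ) : ℝ :=
  1 + 2 * ∑ k ∈ Finset.range n, cos (2 * (k + 1 : ℝ) * u) + cos (2 * (n + 1 : ℝ) * u)

lemma DD_cont (n : ℕ) : Continuous (DD n) := by unfold DD; fun_prop

lemma DD_eq (n : ℕ) (u : ℝ) : sin (2 * (n + 1 : ℝ) * u) * cos u = DD n u * sin u := by
  induction n with
  | zero =>
    simp [DD, sin_two_mul, cos_two_mul]
    ring
  | succ n ih =>
    have h : DD (n+1) u = DD n u + cos (2 * (n + 1 : ℝ) * u) + cos (2 * ((n+1 : ℕ) + 1 : ℝ) * u) := by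
      simp only [DD, Finset.sum_range_succ]; push_cast; ring
    have e : 2 * (((n+1 : ℕ) : ℝ) + 1) * u = 2 * (n + 1 : ℝ) * u + 2 * u := by push_cast; ring
    rw [h, add_mul, add_mul, ← ih, e, sin_add, cos_add, sin_two_mul, cos_two_mul]
    linear_combination (2 * sin (2 * (n + 1 : ℝ) * u) * cos u) * sin_sq_add_cos_sq u

lemma int_cos (n : ℕ) : ∫ u in (0:ℝ)..π, cos (2 * (n + 1 : ℝ) * u) = 0 := by
  rw [intervalIntegral.integral_comp_mul_left (f := cos) (by positivity)]
  have : 2 * (n + 1 : ℝ) * π = ((2 * (n + 1) : ℕ) : ℝ) * π := by push_cast; ring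
  simp only [integral_cos, this, sin_nat_mul_pi]
  simp

lemma DD_int (n : ℕ) : ∫ u in (0:ℝ)..π, DD n u = π := by
  unfold DD
  rw [intervalIntegral.integral_add, intervalIntegral.integral_add, intervalIntegral.integral_const_mul,
    intervalIntegral.integral_finsetSum]
  · simp [int_cos]
  all_goals first
    | (intro i _; apply Continuous.intervalIntegrable; fun_prop)
    | (apply Continuous.intervalIntegrable; fun_prop)

lemma int_cos_log (n : ℕ) :
    ∫ u in (0:ℝ)..π, cos (2 * (n + 1 : ℝ) * u) * log (sin u) = - π / (2 * (n + 1 : ℝ)) := by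
  obtain ⟨U, hU, h⟩ := aux_U (2 * (n + 1))
  have h' : ∀ u, sin (2 * (n + 1 : ℝ) * u) = U u * sin u := by
    intro u; rw [← h]; push_cast; rfl
  have hI : IntervalIntegrable (fun u => cos (2 * (n + 1 : ℝ) * u) * log (sin u))
      MeasureTheory.volume 0 π :=
    intervalIntegrable_log_sin.continuousOn_mul (by fun_prop)
  have key := intervalIntegral.integral_eq_sub_of_hasDerivAt_of_le (a := 0) (b := π)
    (f := fun u => sin (2 * (n + 1 : ℝ) * u) * log (sin u))
    (f' := fun u => 2 * (n + 1 : ℝ) * (cos (2 * (n + 1 : ℝ) * u) * log (sin u)) + DD n u)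
    pi_pos.le ?_ ?_ ?_
  · rw [intervalIntegral.integral_add (hI.const_mul _) ((DD_cont n).intervalIntegrable _ _),
      intervalIntegral.integral_const_mul, DD_int] at key
    simp at key
    field_simp
    linarith
  · have : (fun u => sin (2 * (n + 1 : ℝ) * u) * log (sin u)) =
        fun u => U u * (sin u * log (sin u)) := by
      ext u; rw [h']; ring
    rw [this]
    exact (hU.mul (continuous_mul_log.comp continuous_sin)).continuousOn
  · intro u hu
    have hs : sin u ≠ 0 := (sin_pos_of_pos_of_lt_pi hu.1 hu.2).ne'
    have h1 : HasDerivAt (fun u : ℝ => 2 * (n + 1 : ℝ) * u) (2 * (n + 1 : ℝ)) u := by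
      simpa using (hasDerivAt_id u).const_mul (2 * (n + 1 : ℝ))
    refine (h1.sin.mul ((hasDerivAt_sin u).log hs)).congr_deriv ?_
    have h3 : sin (2 * (n + 1 : ℝ) * u) * (cos u / sin u) = DD n u := by
      rw [← mul_div_assoc, DD_eq, mul_div_cancel_right₀ _ hs]
    rw [h3]
    ring
  · exact (hI.const_mul _).add ((DD_cont n).intervalIntegrable _ _)

lemma bern (u : ℝ) (hu : u ∈ Set.Icc 0 π) :
    HasSum (fun n : ℕ => 1 / (n + 1 : ℝ) ^ 2 * cos (2 * (n + 1 : ℝ) * u))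
      (u ^ 2 - π * u + π ^ 2 / 6) := by
  have hx : u / π ∈ Set.Icc (0:ℝ) 1 :=
    ⟨div_nonneg hu.1 pi_pos.le, (div_le_one pi_pos).2 hu.2⟩
  have := hasSum_one_div_nat_pow_mul_cos (k := 1) one_ne_zero hx
  rw [← hasSum_nat_add_iff' 1] at this
  have e1 : (fun n : ℕ => 1 / (n + 1 : ℝ) ^ 2 * cos (2 * (n + 1 : ℝ) * u)) =
      fun n : ℕ => 1 / ((n + 1 : ℕ) : ℝ) ^ (2 * 1) * cos (2 * π * ((n + 1 : ℕ) : ℝ) * (u / π)) := by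
    ext n
    have : 2 * π * ((n + 1 : ℕ) : ℝ) * (u / π) = 2 * (n + 1 : ℝ) * u := by
      push_cast; field_simp
    rw [this]; push_cast; rfl
  rw [e1]
  have e2 : ∀ (f : ℕ → ℝ) (a b : ℝ), HasSum f a → a = b → HasSum f b := fun f a b h h' => h' ▸ h
  refine e2 _ _ _ this ?_
  simp [Polynomial.bernoulli, Finset.sum_range_succ, bernoulli_one,
    bernoulli_eq_bernoulli'_of_ne_one, Polynomial.eval_monomial]
  norm_num [Nat.choose]
  field_simp
  ring

lemma int_bern : ∫ u in (0:ℝ)..π, (u ^ 2 - π * u + π ^ 2 / 6) * log (sin u)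
    = - (π / 2) * ∑' n : ℕ, 1 / (n + 1 : ℝ) ^ 3 := by
  have hs : Summable (fun n : ℕ => 1 / (n + 1 : ℝ) ^ 2) := by
    have := (summable_nat_add_iff 1).2 (Real.summable_one_div_nat_pow.2 (one_lt_two))
    simpa using this
  have hI : IntervalIntegrable (fun u => log (sin u)) MeasureTheory.volume 0 π :=
    intervalIntegrable_log_sin
  have := intervalIntegral.hasSum_integral_of_dominated_convergence (a := 0) (b := π)
    (μ := MeasureTheory.volume)
    (F := fun n : ℕ => fun u => 1 / (n + 1 : ℝ) ^ 2 * cos (2 * (n + 1 : ℝ) * u) * log (sin u))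
    (f := fun u => (u ^ 2 - π * u + π ^ 2 / 6) * log (sin u))
    (fun n u => 1 / (n + 1 : ℝ) ^ 2 * |log (sin u)|) ?_ ?_ ?_ ?_ ?_
  · rw [← this.tsum_eq, ← tsum_mul_left]
    congr 1
    ext n
    simp only [mul_assoc, intervalIntegral.integral_const_mul]
    have := int_cos_log n
    simp only [mul_assoc] at this
    rw [this]
    field_simp
  · intro n
    have : Continuous fun u : ℝ => 1 / (n + 1 : ℝ) ^ 2 * cos (2 * (n + 1 : ℝ) * u) := by fun_prop
    have h2 := (hI.continuousOn_mul this.continuousOn).def'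
    exact h2.aestronglyMeasurable
  · intro n
    refine Filter.Eventually.of_forall fun u _ => ?_
    rw [norm_mul, norm_mul, norm_eq_abs, norm_eq_abs, norm_eq_abs, abs_of_nonneg (by positivity)]
    have := abs_cos_le_one (2 * (n + 1 : ℝ) * u)
    gcongr
    exact mul_le_of_le_one_right (by positivity) this
  · exact Filter.Eventually.of_forall fun u _ => hs.mul_right _
  · simp only [tsum_mul_right]
    exact hI.abs.const_mul _
  · refine Filter.Eventually.of_forall fun u hu => ?_
    rw [Set.uIoc_of_le pi_pos.le] at hu
    exact (bern u ⟨hu.1.le, hu.2⟩).mul_right _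

lemma int_sq_log_sin : ∫ u in (0:ℝ)..π, u ^ 2 * log (sin u)
    = - (π ^ 3 / 3) * log 2 - (π / 2) * ∑' n : ℕ, 1 / (n + 1 : ℝ) ^ 3 := by
  have hI : ∀ f : ℝ → ℝ, Continuous f → IntervalIntegrable (fun u => f u * log (sin u))
      MeasureTheory.volume 0 π := fun f hf =>
    intervalIntegrable_log_sin.continuousOn_mul hf.continuousOn
  have h1 : ∫ u in (0:ℝ)..π, u * log (sin u) = ∫ u in (0:ℝ)..π, (π - u) * log (sin u) := by
    have := intervalIntegral.integral_comp_sub_left (a := 0) (b := π) (fun u => (π - u) * log (sin u)) π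
    simpa [sin_pi_sub] using this
  have h2 : ∫ u in (0:ℝ)..π, (π - u) * log (sin u)
      = π * (∫ u in (0:ℝ)..π, log (sin u)) - ∫ u in (0:ℝ)..π, u * log (sin u) := by
    rw [← intervalIntegral.integral_const_mul, ← intervalIntegral.integral_sub]
    · congr 1; ext u; ring
    · exact hI (fun _ => π) continuous_const
    · exact hI (fun u => u) continuous_id
  have h3 : ∫ u in (0:ℝ)..π, (u ^ 2 - π * u + π ^ 2 / 6) * log (sin u)
      = (∫ u in (0:ℝ)..π, u ^ 2 * log (sin u)) - π * (∫ u in (0:ℝ)..π, u * log (sin u))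
        + π ^ 2 / 6 * (∫ u in (0:ℝ)..π, log (sin u)) := by
    rw [← intervalIntegral.integral_const_mul, ← intervalIntegral.integral_const_mul,
      ← intervalIntegral.integral_sub, ← intervalIntegral.integral_add]
    · congr 1; ext u; ring
    · exact (hI (fun u => u^2) (by fun_prop)).sub ((hI (fun u => u) continuous_id).const_mul _)
    · exact hI (fun _ => π ^ 2 / 6) continuous_const
    · exact hI (fun u => u^2) (by fun_prop)
    · exact (hI (fun u => u) continuous_id).const_mul _
  rw [int_bern, integral_log_sin_zero_pi] at h3
  rw [integral_log_sin_zero_pi] at h2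
  linear_combination -h3 + π / 2 * (h1 + h2)

lemma int_sq_log : ∫ x in (0:ℝ)..(π/2), x ^ 2 * (log (sin (2 * x)) - log 2)
    = - (π ^ 3 / 12) * log 2 - (π / 16) * ∑' n : ℕ, 1 / (n + 1 : ℝ) ^ 3 := by
  have h := intervalIntegral.integral_comp_mul_left (a := 0) (b := π/2)
    (fun u => u ^ 2 * log (sin u)) (two_ne_zero (α := ℝ))
  rw [mul_zero, mul_div_cancel₀ _ two_ne_zero, int_sq_log_sin] at h
  have hI : IntervalIntegrable (fun x => log (sin (2 * x))) MeasureTheory.volume 0 (π/2) := by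
    simpa using (intervalIntegrable_log_sin (a := 0) (b := π)).comp_mul_left (c := 2)
  have : ∀ x : ℝ, x ^ 2 * (log (sin (2 * x)) - log 2)
    = (1/4) * ((2 * x)^2 * log (sin (2 * x))) - x ^ 2 * log 2 := by intro x; ring
  simp only [this]
  rw [intervalIntegral.integral_sub, intervalIntegral.integral_const_mul, h,
    intervalIntegral.integral_mul_const, integral_pow]
  · simp only [smul_eq_mul]; push_cast; ring
  · exact (hI.continuousOn_mul (by fun_prop : ContinuousOn (fun x : ℝ => (2 * x)^2) _)).const_mul _
  · apply Continuous.intervalIntegrable; fun_prop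

noncomputable def LL (z : ℂ) : ℂ := Complex.log ((1 + z) / 2)
noncomputable def GG (z : ℂ) : ℂ := LL z ^ 3 * ((1 + z) / (1 - z))

lemma slit {z : ℂ} (hz : ‖z‖ ≤ 1) (h : z ≠ -1) : (1 + z) / 2 ∈ Complex.slitPlane := by
  left
  have h1 : 0 < 1 + z.re := by
    by_contra! hc
    apply h
    have h2 : z.re ^ 2 + z.im ^ 2 ≤ 1 := by
      have := Complex.sq_norm z
      rw [Complex.normSq_apply] at this
      nlinarith [norm_nonneg z]
    have h3 : z.re = -1 := by nlinarith [sq_nonneg z.im]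
    have h4 : z.im = 0 := by rw [h3] at h2; nlinarith [sq_nonneg z.im]
    apply Complex.ext <;> simp [h3, h4]
  have : ((1 + z) / 2).re = (1 + z.re) / 2 := by simp
  rw [this]; linarith

lemma LL_diff {z : ℂ} (hz : ‖z‖ ≤ 1) (h : z ≠ -1) : DifferentiableAt ℂ LL z := by
  unfold LL
  exact DifferentiableAt.clog (by fun_prop) (slit hz h)

lemma t_log_cont : ContinuousAt (fun t : ℂ => Complex.log t ^ 3 * t) 0 := by
  have hb : ∀ t : ℂ, ‖Complex.log t ^ 3 * t‖ ≤
      (3 * |‖t‖ ^ (1/3 : ℝ) * log (‖t‖ ^ (1/3 : ℝ))| + π * ‖t‖ ^ (1/3 : ℝ)) ^ 3 := by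
    intro t
    have h1 : ‖Complex.log t‖ ≤ |log ‖t‖| + π := by
      refine (Complex.norm_le_abs_re_add_abs_im _).trans ?_
      rw [Complex.log_re, Complex.log_im]
      have := Complex.abs_arg_le_pi t
      linarith
    have h0 := norm_nonneg t
    have h2 : ‖t‖ = (‖t‖ ^ (1/3 : ℝ)) ^ 3 := by
      rw [← Real.rpow_natCast, ← Real.rpow_mul h0]; norm_num
    set s := ‖t‖ ^ (1/3 : ℝ) with hs
    have hs0 : 0 ≤ s := by positivity
    rw [norm_mul, norm_pow]
    have h3 : 3 * |s * log s| + π * s = (|log ‖t‖| + π) * s := by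
      rw [h2, Real.log_pow, abs_mul, abs_mul, abs_of_nonneg hs0]
      push_cast
      rw [abs_of_nonneg (by norm_num : (0:ℝ) ≤ 3)]
      ring
    rw [h3, mul_pow, ← h2]
    gcongr
  have hc : Continuous (fun t : ℂ =>
      (3 * |‖t‖ ^ (1/3 : ℝ) * log (‖t‖ ^ (1/3 : ℝ))| + π * ‖t‖ ^ (1/3 : ℝ)) ^ 3) := by
    have h1 : Continuous (fun t : ℂ => ‖t‖ ^ (1/3 : ℝ)) :=
      continuous_norm.rpow_const (fun _ => Or.inr (by norm_num))
    have h2 : Continuous (fun t : ℂ => ‖t‖ ^ (1/3 : ℝ) * log (‖t‖ ^ (1/3 : ℝ))) :=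
      continuous_mul_log.comp h1
    fun_prop
  unfold ContinuousAt
  have hl := hc.tendsto 0
  simp only [mul_zero]
  have : (0:ℝ) ^ (1/3 : ℝ) = 0 := Real.zero_rpow (by norm_num)
  simp only [norm_zero, this] at hl
  norm_num at hl
  exact squeeze_zero_norm (by simpa using hb) (by simpa using hl)

lemma GG_cont : ContinuousOn GG (Metric.closedBall 0 1) := by
  intro z hz
  apply ContinuousAt.continuousWithinAt
  have hz1 : ‖z‖ ≤ 1 := by simpa using hz
  by_cases h1 : z = -1
  · subst h1
    have : GG = fun z => (fun t : ℂ => Complex.log t ^ 3 * t) ((1 + z) / 2) * (2 / (1 - z)) := by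
      ext z; simp only [GG, LL]; ring
    rw [this]
    apply ContinuousAt.mul
    · apply ContinuousAt.comp (g := fun t : ℂ => Complex.log t ^ 3 * t)
      · convert t_log_cont using 1; norm_num
      · fun_prop
    · apply ContinuousAt.div (by fun_prop) (by fun_prop); norm_num
  have hL := LL_diff hz1 h1
  by_cases h2 : z = 1
  · subst h2
    have h0 : LL 1 = 0 := by simp [LL]
    have : GG = fun z => -(dslope LL 1 z * LL z ^ 2 * (1 + z)) := by
      ext z
      by_cases h : z = 1
      · subst h; simp [GG, h0]
      · rw [dslope_of_ne _ h, slope_def_field, h0, GG]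
        have h3 : 1 - z ≠ 0 := sub_ne_zero.2 (Ne.symm h)
        have h4 : z - 1 ≠ 0 := sub_ne_zero.2 h
        field_simp
        ring
    rw [this]
    have h5 := continuousAt_dslope_same.2 hL
    have h6 := hL.continuousAt
    fun_prop
  · have h6 := hL.continuousAt
    have : 1 - z ≠ 0 := sub_ne_zero.2 (Ne.symm h2)
    unfold GG
    exact (h6.pow 3).mul (ContinuousAt.div (by fun_prop) (by fun_prop) this)

lemma GG_avg : circleAverage GG 0 1 = - (log 2 : ℂ) ^ 3 := by
  rw [circleAverage_of_differentiable_on_off_countable Set.countable_empty]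
  · have : LL 0 = - (log 2 : ℂ) := by
      simp only [LL, add_zero]
      rw [show (1 / 2 : ℂ) = ((1/2 : ℝ) : ℂ) by push_cast; rfl, ← Complex.ofReal_log (by norm_num)]
      rw [one_div, Real.log_inv]; push_cast; rfl
    simp [GG, this]; ring
  · simpa using GG_cont
  · intro z hz
    have hz1 : ‖z‖ < 1 := by simpa using hz.1
    have hL : DifferentiableAt ℂ LL z := LL_diff hz1.le (by rintro rfl; simp at hz1)
    have : 1 - z ≠ 0 := sub_ne_zero.2 (by rintro rfl; simp at hz1)
    unfold GG
    exact (hL.pow 3).mul (DifferentiableAt.div (by fun_prop) (by fun_prop) this)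

noncomputable def gg (x : ℝ) : ℝ := - (GG (circleMap 0 1 (2 * x))).re

lemma cm_mem (θ : ℝ) : circleMap 0 1 θ ∈ Metric.closedBall (0:ℂ) 1 := by simp

lemma GGc : Continuous fun θ : ℝ => GG (circleMap 0 1 θ) :=
  GG_cont.comp_continuous (continuous_circleMap 0 1) cm_mem

lemma gg_cont : Continuous gg := by
  unfold gg
  exact (Complex.continuous_re.comp (GGc.comp (continuous_const.mul continuous_id))).neg

lemma GG_conj {z : ℂ} (hz : ‖z‖ ≤ 1) : GG ((starRingEnd ℂ) z) = (starRingEnd ℂ) (GG z) := by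
  by_cases h : z = -1
  · subst h; simp [GG]
  · have h1 := slit hz h
    have : LL ((starRingEnd ℂ) z) = (starRingEnd ℂ) (LL z) := by
      unfold LL
      rw [← Complex.log_conj _ (Complex.slitPlane_arg_ne_pi h1)]
      rw [map_div₀, map_add, map_one, Complex.conj_ofNat]
    simp [GG, this]

lemma gg_symm (x : ℝ) : gg (π - x) = gg x := by
  unfold gg
  have : circleMap 0 1 (2 * (π - x)) = (starRingEnd ℂ) (circleMap 0 1 (2 * x)) := by
    simp only [circleMap, ← Complex.exp_conj, map_add, map_mul, map_zero, Complex.conj_ofReal, Complex.conj_I]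
    congr 2
    rw [show (((2 * (π - x) : ℝ) : ℂ) * Complex.I) = ((2 * x : ℝ) : ℂ) * -Complex.I + 2 * π * Complex.I by push_cast; ring,
      Complex.exp_add, Complex.exp_two_pi_mul_I, mul_one]
  rw [this, GG_conj (by simp), Complex.conj_re]

lemma gg_int : ∫ x in (0:ℝ)..(π/2), gg x = π / 2 * log 2 ^ 3 := by
  have h1 : ∫ x in (0:ℝ)..π, gg x = π * log 2 ^ 3 := by
    have h := GG_avg
    rw [circleAverage_def] at h
    have h2 : ∫ θ in (0:ℝ)..(2 * π), (GG (circleMap 0 1 θ)).re = - (2 * π * log 2 ^ 3) := by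
      have h3 := Complex.reCLM.intervalIntegral_comp_comm (GGc.intervalIntegrable (μ := MeasureTheory.volume) 0 (2 * π))
      simp only [Complex.reCLM_apply] at h3
      rw [h3]
      have h4 := congrArg Complex.re h
      rw [Complex.smul_re, show (-(log 2 : ℂ) ^ 3) = ((-(log 2)^3 : ℝ) : ℂ) by push_cast; rfl, Complex.ofReal_re, smul_eq_mul] at h4
      field_simp at h4
      linarith
    unfold gg
    rw [intervalIntegral.integral_comp_mul_left (fun θ => - (GG (circleMap 0 1 θ)).re) two_ne_zero]
    rw [intervalIntegral.integral_neg, mul_zero, h2, smul_eq_mul]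
    ring
  have h2 := intervalIntegral.integral_add_adjacent_intervals (gg_cont.intervalIntegrable (μ := MeasureTheory.volume) 0 (π/2))
    (gg_cont.intervalIntegrable (μ := MeasureTheory.volume) (π/2) π)
  have h3 := intervalIntegral.integral_comp_sub_left (a := π/2) (b := π) gg π
  simp only [gg_symm, sub_self, show π - π/2 = π/2 by ring] at h3
  linarith

lemma gg_eq {x : ℝ} (hx : x ∈ Set.Ioo 0 (π/2)) :
    gg x = cos x / sin x * (3 * log (cos x) ^ 2 * x - x ^ 3) := by
  have hc : 0 < cos x := cos_pos_of_mem_Ioo ⟨by linarith [hx.1, pi_pos], hx.2⟩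
  have hs : 0 < sin x := sin_pos_of_pos_of_lt_pi hx.1 (by linarith [hx.2, pi_pos])
  set e := Complex.exp (x * Complex.I) with he
  have he0 : e ≠ 0 := Complex.exp_ne_zero _
  have hz : circleMap 0 1 (2 * x) = e ^ 2 := by
    simp only [circleMap, he, ← Complex.exp_nat_mul]
    push_cast; simp; ring_nf
  have hee : e = cos x + sin x * Complex.I := by
    rw [he, Complex.exp_mul_I]; push_cast; rfl
  have hp : (sin x : ℂ) ^ 2 + (cos x : ℂ) ^ 2 = 1 := by
    rw [← Complex.ofReal_pow, ← Complex.ofReal_pow, ← Complex.ofReal_add, sin_sq_add_cos_sq]; simp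
  have h1 : 1 + e ^ 2 = 2 * cos x * e := by
    rw [hee]
    linear_combination (-1 : ℂ) * hp + (sin x : ℂ) ^ 2 * Complex.I_sq
  have h2 : 1 - e ^ 2 = -(2 * sin x * Complex.I) * e := by
    rw [hee]
    linear_combination (-1 : ℂ) * hp + (sin x : ℂ) ^ 2 * Complex.I_sq
  have hL : LL (e ^ 2) = (log (cos x) : ℂ) + x * Complex.I := by
    unfold LL
    rw [h1, show 2 * (cos x : ℂ) * e / 2 = cos x * e by ring, Complex.log_ofReal_mul hc he0]
    rw [he, Complex.log_exp]
    · simp; linarith [hx.1, pi_pos]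
    · simp; linarith [hx.2, pi_pos]
  have hsC : (sin x : ℂ) ≠ 0 := by exact_mod_cast hs.ne'
  have h3 : (1 + e ^ 2) / (1 - e ^ 2) = ((cos x / sin x : ℝ) : ℂ) * Complex.I := by
    have hne : -(2 * (sin x : ℂ) * Complex.I) * e ≠ 0 :=
      mul_ne_zero (neg_ne_zero.2 (mul_ne_zero (mul_ne_zero two_ne_zero hsC) Complex.I_ne_zero)) he0
    rw [h1, h2, div_eq_iff hne, Complex.ofReal_div]
    generalize (sin x : ℂ) = s at *
    generalize (cos x : ℂ) = c at *
    have : c / s * Complex.I * (-(2 * s * Complex.I) * e) = - (c / s * s) * 2 * e * Complex.I ^ 2 := by ring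
    rw [this, Complex.I_sq, div_mul_cancel₀ _ hsC]
    ring
  unfold gg
  rw [hz, GG, hL, h3]
  have : ((log (cos x) : ℂ) + x * Complex.I) ^ 3 * (((cos x / sin x : ℝ) : ℂ) * Complex.I)
     = ((-(cos x / sin x * (3 * log (cos x) ^ 2 * x - x ^ 3)) : ℝ) : ℂ)
       + ((cos x / sin x * (log (cos x) ^ 3 - 3 * log (cos x) * x ^ 2) : ℝ) : ℂ) * Complex.I := by
    generalize cos x / sin x = q
    generalize log (cos x) = l
    push_cast
    have h4 : Complex.I ^ 4 = 1 := Complex.I_pow_four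
    have h3 : Complex.I ^ 3 = -Complex.I := Complex.I_pow_three
    linear_combination (3 * q * (l:ℂ)^2 * x) * Complex.I_sq + q * x ^ 3 * h4 + 3 * q * l * x ^ 2 * h3
  rw [this]
  simp only [Complex.add_re, Complex.ofReal_re, Complex.mul_re, Complex.I_re, Complex.ofReal_im, Complex.I_im]
  ring

noncomputable def KK (x : ℝ) : ℝ :=
  - (x * (sinc x)⁻¹ * (2 * (√(cos x) * log (√(cos x)))) ^ 2)
   + 2 / 3 * (x ^ 2 * (sinc x)⁻¹ * (sin x * log (sin x)))

lemma KK_cont : ContinuousOn KK (Set.Icc 0 (π/2)) := by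
  have h0 : ContinuousOn (fun x => (sinc x)⁻¹) (Set.Icc 0 (π/2)) := by
    apply continuous_sinc.continuousOn.inv₀
    intro x hx
    by_cases h : x = 0
    · simp [h]
    · rw [sinc_of_ne_zero h]
      have : 0 < x := lt_of_le_of_ne hx.1 (Ne.symm h)
      have hs : 0 < sin x := sin_pos_of_pos_of_lt_pi this (by linarith [hx.2, pi_pos])
      positivity
  have h1 : Continuous fun x => √(cos x) * log (√(cos x)) :=
    continuous_mul_log.comp (continuous_sqrt.comp continuous_cos)
  have h2 : Continuous fun x => sin x * log (sin x) := continuous_mul_log.comp continuous_sin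
  unfold KK
  exact (((continuousOn_id.mul h0).mul ((h1.const_mul 2).pow 2).continuousOn).neg).add
    ((((continuousOn_id.pow 2).mul h0).mul h2.continuousOn).const_mul _)

lemma KK_eq {x : ℝ} (hx : x ∈ Set.Ioo 0 (π/2)) :
    KK x = - (x ^ 2 * (cos x / sin x) * log (cos x) ^ 2) + 2 / 3 * (x ^ 3 * log (sin x)) := by
  have hc : 0 < cos x := cos_pos_of_mem_Ioo ⟨by linarith [hx.1, pi_pos], hx.2⟩
  have hs : 0 < sin x := sin_pos_of_pos_of_lt_pi hx.1 (by linarith [hx.2, pi_pos])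
  have h0 := hx.1.ne'
  unfold KK
  rw [sinc_of_ne_zero h0, Real.log_sqrt hc.le, show (2 * (√(cos x) * (log (cos x) / 2))) ^ 2
    = (√(cos x))^2 * log (cos x) ^ 2 by ring, sq_sqrt hc.le]
  field_simp

lemma KK_deriv {x : ℝ} (hx : x ∈ Set.Ioo 0 (π/2)) :
    HasDerivAt KK (x ^ 2 * (1 / sin x) ^ 2 * log (cos x) ^ 2
      - 2 / 3 * gg x + 2 * (x ^ 2 * (log (sin (2 * x)) - log 2))) x := by
  have hc : 0 < cos x := cos_pos_of_mem_Ioo ⟨by linarith [hx.1, pi_pos], hx.2⟩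
  have hs : 0 < sin x := sin_pos_of_pos_of_lt_pi hx.1 (by linarith [hx.2, pi_pos])
  have he : KK =ᶠ[nhds x] fun x => - (x ^ 2 * (cos x / sin x) * log (cos x) ^ 2)
      + 2 / 3 * (x ^ 3 * log (sin x)) := by
    filter_upwards [isOpen_Ioo.mem_nhds hx] with y hy using KK_eq hy
  refine HasDerivAt.congr_of_eventuallyEq ?_ he
  have hl : log (sin (2 * x)) - log 2 = log (sin x) + log (cos x) := by
    rw [sin_two_mul, log_mul (by positivity) hc.ne', log_mul two_ne_zero hs.ne']; ring
  rw [gg_eq hx, hl]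
  have d1 := (((hasDerivAt_pow 2 x).mul ((hasDerivAt_cos x).div (hasDerivAt_sin x) hs.ne')).mul
    (((hasDerivAt_cos x).log hc.ne').pow 2)).neg
  have d2 := ((hasDerivAt_pow 3 x).mul ((hasDerivAt_sin x).log hs.ne')).const_mul (2/3)
  refine (d1.add d2).congr_deriv ?_
  have hp : sin x ^ 2 = 1 - cos x ^ 2 := by linarith [sin_sq_add_cos_sq x]
  simp only [Pi.mul_apply, Pi.pow_apply, Pi.div_apply]
  push_cast
  have e1 : (-sin x * sin x - cos x * cos x) = -1 := by linarith [sin_sq_add_cos_sq x]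
  rw [e1]
  field_simp
  ring

noncomputable def qq (x : ℝ) : ℝ := x ^ 2 * (log (sin (2 * x)) - log 2)

lemma qq_int : IntervalIntegrable qq MeasureTheory.volume 0 (π/2) := by
  have hI : IntervalIntegrable (fun x => log (sin (2 * x))) MeasureTheory.volume 0 (π/2) := by
    simpa using (intervalIntegrable_log_sin (a := 0) (b := π)).comp_mul_left (c := 2)
  exact (hI.sub intervalIntegrable_const).continuousOn_mul (by fun_prop)

lemma main_int : ∫ x in (0 : ℝ)..(π / 2), x ^ 2 * (1 / sin x) ^ 2 * (log (cos x)) ^ 2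
    = 2 / 3 * (∫ x in (0:ℝ)..(π/2), gg x) - 2 * ∫ x in (0:ℝ)..(π/2), qq x := by
  have hp : (0:ℝ) ≤ π / 2 := by positivity
  set M : ℝ → ℝ := fun x => KK x + 2 / 3 * (∫ t in (0:ℝ)..x, gg t) - 2 * ∫ t in (0:ℝ)..x, qq t with hM
  have hcont : ContinuousOn M (Set.Icc 0 (π/2)) := by
    have h1 : ContinuousOn (fun x => ∫ t in (0:ℝ)..x, qq t) (Set.Icc 0 (π/2)) := by
      have := intervalIntegral.continuousOn_primitive_interval' (a := 0) qq_int (by simp)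
      rwa [Set.uIcc_of_le hp] at this
    have h2 : Continuous (fun x => ∫ t in (0:ℝ)..x, gg t) :=
      intervalIntegral.continuous_primitive (fun a b => gg_cont.intervalIntegrable a b) 0
    exact (KK_cont.add (h2.continuousOn.const_mul _)).sub (h1.const_mul _)
  have hd : ∀ x ∈ Set.Ioo 0 (π/2), HasDerivAt M (x ^ 2 * (1 / sin x) ^ 2 * log (cos x) ^ 2) x := by
    intro x hx
    have hs : sin (2 * x) ≠ 0 :=
      (sin_pos_of_pos_of_lt_pi (by linarith [hx.1]) (by linarith [hx.2])).ne'
    have hq : ∀ y ∈ Set.Ioo 0 (π/2), ContinuousAt qq y := by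
      intro y hy
      have hs : sin (2 * y) ≠ 0 :=
        (sin_pos_of_pos_of_lt_pi (by linarith [hy.1]) (by linarith [hy.2])).ne'
      unfold qq
      fun_prop (disch := assumption)
    have h1 : HasDerivAt (fun x => ∫ t in (0:ℝ)..x, qq t) (qq x) x := by
      apply intervalIntegral.integral_hasDerivAt_right
      · apply qq_int.mono_set
        rw [Set.uIcc_of_le hp, Set.uIcc_of_le hx.1.le]
        exact Set.Icc_subset_Icc_right hx.2.le
      · exact ContinuousAt.stronglyMeasurableAtFilter isOpen_Ioo hq x hx
      · exact hq x hx
    have h2 : HasDerivAt (fun x => ∫ t in (0:ℝ)..x, gg t) (gg x) x :=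
      gg_cont.integral_hasStrictDerivAt 0 x |>.hasDerivAt
    refine (((KK_deriv hx).add (h2.const_mul (2/3))).sub (h1.const_mul 2)).congr_deriv ?_
    simp only [qq]; ring
  have hi : IntervalIntegrable (fun x => x ^ 2 * (1 / sin x) ^ 2 * log (cos x) ^ 2)
      MeasureTheory.volume 0 (π/2) := by
    rw [intervalIntegrable_iff_integrableOn_Ioc_of_le hp]
    exact intervalIntegral.integrableOn_deriv_of_nonneg hcont hd (fun x _ => by positivity)
  rw [intervalIntegral.integral_eq_sub_of_hasDerivAt_of_le hp hcont hd hi]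
  simp [hM, KK]

theorem stmt_10 :
    ∫ x in (0 : ℝ)..(π / 2), x ^ 2 * (1 / Real.sin x) ^ 2 * (Real.log (Real.cos x)) ^ 2
    = π / 8 * zetaVal 3 + π ^ 3 / 6 * Real.log 2 + π / 3 * Real.log 2 ^ 3 := by
  rw [main_int, gg_int]
  have h := int_sq_log
  unfold qq zetaVal
  rw [h]
  ring
end

section
/- ∫_0^{π/2} ln^3(sin(x)) dx = −(3π/4)ζ(3) − (π^3/8) ln(2) − (π/2) ln^3(2). -/
open Real

open Set Filter Topology MeasureTheory

/-- `log (1 - r e^{2ix})`. -/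
noncomputable def gFun (r x : ℝ) : ℂ := Complex.log (1 - (r : ℂ) * Complex.exp (2 * Complex.I * x))

lemma gFun_meas (r : ℝ) : Measurable (gFun r) := by
  unfold gFun
  fun_prop

lemma bound_integrable (C : ℝ) :
    IntervalIntegrable (fun x : ℝ => C * (x ^ (-(1/2) : ℝ) + (π - x) ^ (-(1/2) : ℝ))) volume 0 π := by
  apply IntervalIntegrable.const_mul
  apply IntervalIntegrable.add
  · exact intervalIntegral.intervalIntegrable_rpow' (by norm_num)
  · have := (intervalIntegral.intervalIntegrable_rpow' (a := 0) (b := π) (r := (-(1/2) : ℝ))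
      (by norm_num)).comp_sub_left π
    simpa using this.symm

lemma sin_rpow_le {x : ℝ} (hx : x ∈ Ioo 0 π) :
    (sin x) ^ (-(1/2) : ℝ) ≤ (2 / π) ^ (-(1/2) : ℝ) * (x ^ (-(1/2) : ℝ) + (π - x) ^ (-(1/2) : ℝ)) := by
  have h1 : 0 < x := hx.1
  have h2 : 0 < π - x := by linarith [hx.2]
  have hp : 0 < 2 / π := by positivity
  rw [mul_add, ← Real.mul_rpow hp.le h1.le, ← Real.mul_rpow hp.le h2.le]
  rcases le_total x (π / 2) with h | h
  · have := Real.rpow_le_rpow_of_nonpos (by positivity) (Real.mul_le_sin h1.le h)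
      (show (-(1/2) : ℝ) ≤ 0 by norm_num)
    have h3 : 0 ≤ (2 / π * (π - x)) ^ (-(1/2) : ℝ) := by positivity
    linarith
  · have := Real.rpow_le_rpow_of_nonpos (by positivity)
      (Real.mul_le_sin h2.le (by linarith)) (show (-(1/2) : ℝ) ≤ 0 by norm_num)
    rw [Real.sin_pi_sub] at this
    have h3 : 0 ≤ (2 / π * x) ^ (-(1/2) : ℝ) := by positivity
    linarith

lemma norm_e (x : ℝ) : ‖Complex.exp (2 * Complex.I * x)‖ = 1 := by
  rw [show 2 * Complex.I * (x : ℂ) = ((2 * x : ℝ) : ℂ) * Complex.I by push_cast; ring]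
  exact Complex.norm_exp_ofReal_mul_I _

lemma one_sub_e (x : ℝ) : 1 - Complex.exp (2 * Complex.I * x) =
    ((2 * sin x : ℝ) : ℂ) * Complex.exp (((x - π / 2 : ℝ) : ℂ) * Complex.I) := by
  have h : Complex.exp (((x - π / 2 : ℝ) : ℂ) * Complex.I) = -Complex.I * Complex.exp (x * Complex.I) := by
    push_cast
    rw [sub_mul, Complex.exp_sub, Complex.exp_pi_div_two_mul_I]
    field_simp
    simp
  rw [h, show 2 * Complex.I * (x : ℂ) = x * Complex.I + x * Complex.I by ring, Complex.exp_add]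
  push_cast
  rw [Complex.sin]
  have h2 : Complex.exp (-(x:ℂ) * Complex.I) * Complex.exp (x * Complex.I) = 1 := by
    rw [← Complex.exp_add]; simp
  linear_combination (-1 : ℂ) * h2 + (Complex.exp (-(x:ℂ) * Complex.I) * Complex.exp (x * Complex.I) - Complex.exp (x * Complex.I)^2) * Complex.I_sq

lemma gFun_one {x : ℝ} (hx : x ∈ Ioo 0 π) :
    gFun 1 x = ((log 2 + log (sin x) : ℝ) : ℂ) + ((x - π / 2 : ℝ) : ℂ) * Complex.I := by
  have hs : 0 < sin x := Real.sin_pos_of_mem_Ioo hx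
  have h := one_sub_e x
  unfold gFun
  rw [← Real.log_mul (by norm_num) hs.ne', Complex.ofReal_one, one_mul, h]
  rw [Complex.log_ofReal_mul (by positivity) (Complex.exp_ne_zero _), Complex.log_exp]
  · simp; linarith [hx.1, Real.pi_pos]
  · simp; linarith [hx.2, Real.pi_pos]

lemma sin_le_norm {r x : ℝ} (hr : r ∈ Icc (0:ℝ) 1) (hx : x ∈ Ioo 0 π) :
    sin x ≤ ‖1 - (r : ℂ) * Complex.exp (2 * Complex.I * x)‖ := by
  have hs : 0 < sin x := Real.sin_pos_of_mem_Ioo hx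
  set e := Complex.exp (2 * Complex.I * x) with he
  have h1 : ‖1 - e‖ = 2 * sin x := by
    rw [he, one_sub_e, norm_mul, Complex.norm_exp_ofReal_mul_I, Complex.norm_real, mul_one,
      Real.norm_of_nonneg (by positivity)]
  have hre : ‖(r : ℂ) * e‖ = r := by
    rw [norm_mul, norm_e, mul_one, Complex.norm_real, Real.norm_of_nonneg hr.1]
  have h2 : ‖1 - e‖ ≤ ‖1 - (r : ℂ) * e‖ + ‖((r - 1 : ℝ) : ℂ) * e‖ := by
    have h := norm_add_le (1 - (r : ℂ) * e) (((r - 1 : ℝ) : ℂ) * e)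
    rwa [show 1 - (r : ℂ) * e + ((r - 1 : ℝ) : ℂ) * e = 1 - e by push_cast; ring] at h
  have h3 : ‖((r - 1 : ℝ) : ℂ) * e‖ = 1 - r := by
    rw [norm_mul, norm_e, mul_one, Complex.norm_real, Real.norm_of_nonpos (by linarith [hr.2])]
    ring
  have h4 : 1 - r ≤ ‖1 - (r : ℂ) * e‖ := by
    have := norm_sub_norm_le (1 : ℂ) ((r : ℂ) * e)
    rw [hre, norm_one] at this
    exact this
  linarith

lemma gFun_bound {r x : ℝ} (hr : r ∈ Icc (0:ℝ) 1) (hx : x ∈ Ioo 0 π) :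
    ‖gFun r x‖ ≤ 12 * (sin x) ^ (-(1/6) : ℝ) := by
  have hs : 0 < sin x := Real.sin_pos_of_mem_Ioo hx
  have hs1 : sin x ≤ 1 := Real.sin_le_one x
  have hn := sin_le_norm hr hx
  set z := 1 - (r : ℂ) * Complex.exp (2 * Complex.I * x) with hz
  have hz2 : ‖z‖ ≤ 2 := by
    have := norm_sub_le (1 : ℂ) ((r : ℂ) * Complex.exp (2 * Complex.I * x))
    rw [norm_mul, norm_e, mul_one, Complex.norm_real, Real.norm_of_nonneg hr.1, norm_one] at this
    linarith [hr.2]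
  have h1 : ‖Complex.log z‖ ≤ |log ‖z‖| + |Complex.arg z| := by
    have := Complex.norm_le_abs_re_add_abs_im (Complex.log z)
    rwa [Complex.log_re, Complex.log_im] at this
  have h2 : |Complex.arg z| ≤ 4 := (Complex.abs_arg_le_pi z).trans Real.pi_le_four
  have hlow : log (sin x) ≤ log ‖z‖ := Real.log_le_log hs hn
  have hup : log ‖z‖ ≤ log 2 := Real.log_le_log (hs.trans_le hn) hz2
  have hl2 : log 2 ≤ 1 := by linarith [Real.log_two_lt_d9]
  have hneg : log (sin x) ≤ 0 := Real.log_nonpos hs.le hs1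
  have h3 : |log ‖z‖| ≤ 1 + |log (sin x)| := by
    rw [abs_of_nonpos hneg, abs_le]
    constructor <;> linarith
  have h4 := Real.abs_log_mul_self_rpow_lt (sin x) (1/6) hs hs1 (by norm_num)
  have hpos : 0 < (sin x) ^ (1/6 : ℝ) := by positivity
  rw [abs_mul, abs_of_pos hpos] at h4
  have h5 : 1 ≤ (sin x) ^ (-(1/6) : ℝ) :=
    Real.one_le_rpow_of_pos_of_le_one_of_nonpos hs hs1 (by norm_num)
  have h6 : |log (sin x)| ≤ 6 * (sin x) ^ (-(1/6) : ℝ) := by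
    rw [Real.rpow_neg hs.le, ← div_eq_mul_inv, le_div_iff₀ hpos]
    norm_num at h4 ⊢
    exact h4.le
  unfold gFun
  rw [← hz]
  linarith

lemma gFun_pow_bound {p : ℕ} (hp : p ≤ 3) {r x : ℝ} (hr : r ∈ Icc (0:ℝ) 1) (hx : x ∈ Ioo 0 π) {w : ℂ}
    (hw : ‖w‖ ≤ 10) :
    ‖gFun r x ^ p * w‖ ≤ (12 ^ 3 * 10 * (2 / π) ^ (-(1/2) : ℝ)) *
      (x ^ (-(1/2) : ℝ) + (π - x) ^ (-(1/2) : ℝ)) := by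
  have hs : 0 < sin x := Real.sin_pos_of_mem_Ioo hx
  have h5 : 1 ≤ (sin x) ^ (-(1/6) : ℝ) :=
    Real.one_le_rpow_of_pos_of_le_one_of_nonpos hs (Real.sin_le_one x) (by norm_num)
  have h1 : ‖gFun r x‖ ^ p ≤ (12 * (sin x) ^ (-(1/6) : ℝ)) ^ 3 :=
    (pow_le_pow_left₀ (norm_nonneg _) (gFun_bound hr hx) p).trans
      (pow_le_pow_right₀ (by linarith) hp)
  have h2 : ((sin x) ^ (-(1/6) : ℝ)) ^ 3 = (sin x) ^ (-(1/2) : ℝ) := by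
    rw [← Real.rpow_natCast, ← Real.rpow_mul hs.le]; norm_num
  rw [mul_pow, h2] at h1
  have h3 := sin_rpow_le hx
  have h4 : 0 ≤ (sin x) ^ (-(1/2) : ℝ) := by positivity
  rw [norm_mul, norm_pow]
  calc _ ≤ (12 ^ 3 * (sin x) ^ (-(1/2) : ℝ)) * 10 := by gcongr
    _ = 12 ^ 3 * 10 * (sin x) ^ (-(1/2) : ℝ) := by ring
    _ ≤ 12 ^ 3 * 10 * ((2 / π) ^ (-(1/2) : ℝ) * (x ^ (-(1/2) : ℝ) + (π - x) ^ (-(1/2) : ℝ))) := by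
      gcongr
    _ = _ := by ring

lemma ae_Ioo : ∀ᵐ x : ℝ, x ∈ uIoc 0 π → x ∈ Ioo 0 π := by
  have : ∀ᵐ x : ℝ, x ≠ π := by simp [ae_iff, measure_singleton]
  filter_upwards [this] with x hx h
  rw [uIoc_of_le Real.pi_pos.le] at h
  exact ⟨h.1, lt_of_le_of_ne h.2 hx⟩

lemma gFun_integrable {p : ℕ} (hp : p ≤ 3) {w : ℝ → ℂ} (hw : Continuous w)
    (hb : ∀ x ∈ Ioo 0 π, ‖w x‖ ≤ 10) {r : ℝ} (hr : r ∈ Icc (0:ℝ) 1) :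
    IntervalIntegrable (fun x => gFun r x ^ p * w x) volume 0 π := by
  refine (bound_integrable (12 ^ 3 * 10 * (2 / π) ^ (-(1/2) : ℝ))).mono_fun' ?_ ?_
  · exact (((gFun_meas r).pow_const p).mul hw.measurable).aestronglyMeasurable
  · rw [EventuallyLE, ae_restrict_iff' measurableSet_uIoc]
    filter_upwards [ae_Ioo] with x hx h
    exact gFun_pow_bound hp hr (hx h) (hb x (hx h))

lemma gFun_tendsto {p : ℕ} (hp : p ≤ 3) {w : ℝ → ℂ} (hw : Continuous w)
    (hb : ∀ x ∈ Ioo 0 π, ‖w x‖ ≤ 10) :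
    Tendsto (fun r => ∫ x in 0..π, gFun r x ^ p * w x) (𝓝[<] 1)
      (𝓝 (∫ x in 0..π, gFun 1 x ^ p * w x)) := by
  have hI : ∀ᶠ r : ℝ in 𝓝[<] 1, r ∈ Icc (0:ℝ) 1 := by
    filter_upwards [Ioo_mem_nhdsLT (show (0:ℝ) < 1 by norm_num)] with r hr
    exact ⟨hr.1.le, hr.2.le⟩
  refine intervalIntegral.tendsto_integral_filter_of_dominated_convergence
    (fun x => (12 ^ 3 * 10 * (2 / π) ^ (-(1/2) : ℝ)) *
      (x ^ (-(1/2) : ℝ) + (π - x) ^ (-(1/2) : ℝ))) ?_ ?_ (bound_integrable _) ?_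
  · exact Eventually.of_forall fun r =>
      (((gFun_meas r).pow_const p).mul hw.measurable).aestronglyMeasurable
  · filter_upwards [hI] with r hr
    filter_upwards [ae_Ioo] with x hx h
    exact gFun_pow_bound hp hr (hx h) (hb x (hx h))
  · filter_upwards [ae_Ioo] with x hx h
    have hx := hx h
    have hs : 0 < sin x := Real.sin_pos_of_mem_Ioo hx
    have hc : ContinuousAt (fun r : ℝ => gFun r x) 1 := by
      unfold gFun
      apply ContinuousAt.clog
      · fun_prop
      · left
        have := congrArg Complex.re (one_sub_e x)
        rw [Complex.ofReal_one, one_mul, this, Complex.re_ofReal_mul, Complex.exp_ofReal_mul_I_re,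
          Real.cos_sub_pi_div_two]
        positivity
    exact (((hc.pow p).mul continuousAt_const).tendsto).mono_left nhdsWithin_le_nhds

lemma gFun_mean {p : ℕ} (hp : p ≠ 0) {r : ℝ} (hr : r ∈ Ioo (0:ℝ) 1) :
    ∫ x in 0..π, gFun r x ^ p = 0 := by
  have h := circleAverage_of_differentiable_on_off_countable (s := ∅) (c := (0:ℂ)) (R := r)
    (f := fun z => Complex.log (1 - z) ^ p) countable_empty ?_ ?_
  · rw [Real.circleAverage_def] at h
    have h2 := intervalIntegral.integral_comp_mul_left (a := 0) (b := π)
      (fun θ => Complex.log (1 - circleMap 0 r θ) ^ p) (two_ne_zero (α := ℝ))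
    have h3 : ∀ x : ℝ, Complex.log (1 - circleMap 0 r (2 * x)) = gFun r x := by
      intro x
      unfold gFun circleMap
      push_cast
      rw [zero_add, show 2 * (x:ℂ) * Complex.I = 2 * Complex.I * x by ring]
    simp only [h3] at h2
    rw [h2, mul_zero]
    have : (∫ θ in 0..2 * π, Complex.log (1 - circleMap 0 r θ) ^ p) = 0 := by
      simpa [hp, Real.pi_ne_zero] using h
    rw [this, smul_zero]
  · intro z hz
    apply ContinuousAt.continuousWithinAt
    apply ContinuousAt.pow
    apply ContinuousAt.clog (by fun_prop)
    left
    have : ‖z‖ ≤ r := by simpa [abs_of_pos hr.1] using hz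
    have := (Complex.re_le_norm z)
    simp; linarith [hr.2]
  · intro z hz
    apply DifferentiableAt.pow
    apply DifferentiableAt.clog (by fun_prop)
    left
    have : ‖z‖ < r := by simpa [abs_of_pos hr.1] using hz.1
    have := (Complex.re_le_norm z)
    simp; linarith [hr.2]

lemma gFun_one_mean {p : ℕ} (hp0 : p ≠ 0) (hp : p ≤ 3) : ∫ x in 0..π, gFun 1 x ^ p = 0 := by
  have h := gFun_tendsto hp (w := fun _ => 1) continuous_const (by intro x _; simp)
  simp only [mul_one] at h
  refine tendsto_nhds_unique h (tendsto_const_nhds.congr' ?_)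
  filter_upwards [Ioo_mem_nhdsLT (show (0:ℝ) < 1 by norm_num)] with r hr
  exact (gFun_mean hp0 hr).symm

lemma fourier_int (k : ℕ) (hk : k ≠ 0) :
    ∫ x in (0:ℝ)..π, Complex.exp (2 * Complex.I * x) ^ k * ((x : ℂ) - π / 2) ^ 2 = (π : ℂ) / (2 * (k : ℂ) ^ 2) := by
  have hk' : (k : ℂ) ≠ 0 := by exact_mod_cast hk
  set a : ℂ := 2 * Complex.I * k with ha
  have ha0 : a ≠ 0 := by simp [ha, hk]
  have hd : ∀ x ∈ uIcc 0 π, HasDerivAt (fun x : ℝ => Complex.exp (a * x) *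
      (((x : ℂ) - π / 2) ^ 2 / a - 2 * ((x : ℂ) - π / 2) / a ^ 2 + 2 / a ^ 3))
      (Complex.exp (2 * Complex.I * x) ^ k * ((x : ℂ) - π / 2) ^ 2) x := by
    intro x _
    have h0 : HasDerivAt (fun z : ℂ => Complex.exp (a * z) *
      ((z - π / 2) ^ 2 / a - 2 * (z - π / 2) / a ^ 2 + 2 / a ^ 3))
      (Complex.exp (a * x) * (a * 1) * (((x:ℂ) - π / 2) ^ 2 / a - 2 * (x - π / 2) / a ^ 2 + 2 / a ^ 3)
       + Complex.exp (a * x) * ((2 : ℕ) * ((x:ℂ) - π / 2) ^ (2 - 1) * 1 / a - 2 * 1 / a ^ 2)) (x : ℂ) := by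
      have hs : HasDerivAt (fun z : ℂ => z - π / 2) 1 (x:ℂ) := (hasDerivAt_id _).sub_const _
      exact (((hasDerivAt_id (x:ℂ)).const_mul a).cexp).mul
        ((((hs.pow 2).div_const a).sub ((hs.const_mul 2).div_const (a^2))).add_const _)
    convert h0.comp_ofReal using 1
    rw [← Complex.exp_nat_mul, show (k:ℂ) * (2 * Complex.I * x) = a * x by rw [ha]; ring]
    field_simp
    push_cast
    ring
  rw [intervalIntegral.integral_eq_sub_of_hasDerivAt hd
    (Continuous.intervalIntegrable (by fun_prop) _ _)]
  have he : Complex.exp (a * π) = 1 := by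
    rw [show a * π = (k:ℂ) * (2 * π * Complex.I) by rw [ha]; ring]
    exact Complex.exp_nat_mul_two_pi_mul_I k
  have ha2 : a ^ 2 = - (4 * (k:ℂ) ^ 2) := by
    rw [ha]; linear_combination 4 * (k:ℂ)^2 * Complex.I_sq
  rw [he]
  simp only [Complex.ofReal_zero, mul_zero, Complex.exp_zero]
  have : (1:ℂ) * ((π - π / 2 : ℂ) ^ 2 / a - 2 * (π - π / 2 : ℂ) / a ^ 2 + 2 / a ^ 3) -
    1 * (((0:ℂ) - π / 2) ^ 2 / a - 2 * ((0:ℂ) - π / 2) / a ^ 2 + 2 / a ^ 3) = - 2 * π / a ^ 2 := by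
    ring
  rw [this, ha2]
  field_simp
  norm_num

lemma w_bound {x : ℝ} (hx : x ∈ Ioo 0 π) : ‖((x : ℂ) - π / 2) ^ 2‖ ≤ 10 := by
  rw [norm_pow, show ((x : ℂ) - π / 2) = ((x - π / 2 : ℝ) : ℂ) by push_cast; ring, Complex.norm_real,
    Real.norm_eq_abs, sq_abs]
  nlinarith [hx.1, hx.2, Real.pi_le_four, Real.pi_pos]

lemma gFun_series {r : ℝ} (hr : r ∈ Ioo (0:ℝ) 1) :
    ∫ x in 0..π, gFun r x ^ 1 * ((x : ℂ) - π / 2) ^ 2 =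
      -(π / 2) * ∑' n : ℕ, ((r ^ n / n ^ 3 : ℝ) : ℂ) := by
  have h := intervalIntegral.hasSum_integral_of_dominated_convergence (a := 0) (b := π)
    (μ := volume)
    (F := fun (n : ℕ) (x : ℝ) => ((r : ℂ) * Complex.exp (2 * Complex.I * x)) ^ n / n *
      ((x : ℂ) - π / 2) ^ 2) (f := fun x => -gFun r x * ((x : ℂ) - π / 2) ^ 2)
    (fun n _ => r ^ n * 10) ?_ ?_ ?_ ?_ ?_
  · have h2 : ∀ n : ℕ, ∫ x in 0..π, ((r : ℂ) * Complex.exp (2 * Complex.I * x)) ^ n / n *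
      ((x : ℂ) - π / 2) ^ 2 = (π / 2) * ((r ^ n / n ^ 3 : ℝ) : ℂ) := by
      intro n
      rcases eq_or_ne n 0 with rfl | hn
      · simp
      have hn' : (n : ℂ) ≠ 0 := by exact_mod_cast hn
      have : ∀ x : ℝ, ((r : ℂ) * Complex.exp (2 * Complex.I * x)) ^ n / n *
        ((x : ℂ) - π / 2) ^ 2 = ((r:ℂ) ^ n / n) *
         (Complex.exp (2 * Complex.I * x) ^ n * ((x : ℂ) - π / 2) ^ 2) := by
        intro x; rw [mul_pow]; ring
      simp only [this]
      rw [intervalIntegral.integral_const_mul, fourier_int n hn]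
      push_cast
      field_simp
    simp only [h2] at h
    have h3 := h.tsum_eq
    rw [tsum_mul_left] at h3
    simp only [neg_mul, intervalIntegral.integral_neg] at h3
    simp only [pow_one]
    rw [neg_mul, h3, neg_neg]
  · intro n
    exact Continuous.aestronglyMeasurable (by fun_prop)
  · intro n
    filter_upwards [ae_Ioo] with x hx h
    have hw := w_bound (hx h)
    rw [norm_mul, norm_div, norm_pow, norm_mul, norm_e, Complex.norm_real,
      Real.norm_of_nonneg hr.1.le, mul_one]
    have hrn : 0 ≤ r ^ n := pow_nonneg hr.1.le n
    gcongr
    rcases eq_or_ne n 0 with rfl | hn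
    · simp
    · apply div_le_self hrn
      rw [Complex.norm_natCast]
      exact_mod_cast Nat.one_le_iff_ne_zero.mpr hn
  · exact Eventually.of_forall fun x _ =>
      (summable_geometric_of_lt_one hr.1.le hr.2).mul_right 10
  · exact intervalIntegrable_const
  · refine Eventually.of_forall fun x _ => ?_
    apply HasSum.mul_right
    apply Complex.hasSum_taylorSeries_neg_log
    rw [norm_mul, norm_e, Complex.norm_real, Real.norm_of_nonneg hr.1.le, mul_one]
    exact hr.2

lemma gFun_one_weighted :
    ∫ x in 0..π, gFun 1 x ^ 1 * ((x : ℂ) - π / 2) ^ 2 = -(π / 2) * (zetaVal 3 : ℂ) := by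
  have hsum : Summable (fun n : ℕ => (1 / (n:ℝ) ^ 3 : ℝ)) :=
    Real.summable_one_div_nat_pow.mpr (by norm_num)
  have hz : zetaVal 3 = ∑' n : ℕ, (1 / (n:ℝ) ^ 3 : ℝ) := by
    rw [hsum.tsum_eq_zero_add]
    simp [zetaVal]
  have h := gFun_tendsto (p := 1) (by norm_num) (w := fun x : ℝ => ((x : ℂ) - π / 2) ^ 2)
    (by fun_prop) (fun x hx => w_bound hx)
  have ht : Tendsto (fun r : ℝ => ∑' n : ℕ, (r ^ n / n ^ 3 : ℝ)) (𝓝[<] 1) (𝓝 (zetaVal 3)) := by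
    rw [hz]
    refine tendsto_tsum_of_dominated_convergence hsum ?_ ?_
    · intro n
      have : Tendsto (fun r : ℝ => r ^ n / (n:ℝ) ^ 3) (𝓝 1) (𝓝 (1 ^ n / (n:ℝ) ^ 3)) :=
        Continuous.tendsto (by fun_prop) 1
      rw [one_pow] at this
      exact this.mono_left nhdsWithin_le_nhds
    · filter_upwards [Ioo_mem_nhdsLT (show (0:ℝ) < 1 by norm_num)] with r hr n
      have hrn : 0 ≤ r ^ n := pow_nonneg hr.1.le n
      rw [Real.norm_of_nonneg (by positivity)]
      gcongr
      exact pow_le_one₀ hr.1.le hr.2.le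
  have ht2 : Tendsto (fun r : ℝ => -(π / 2 : ℂ) * ((∑' n : ℕ, (r ^ n / n ^ 3 : ℝ) : ℝ) : ℂ)) (𝓝[<] 1)
      (𝓝 (-(π / 2) * (zetaVal 3 : ℂ))) :=
    ((Complex.continuous_ofReal.tendsto _).comp ht).const_mul _
  refine tendsto_nhds_unique h (ht2.congr' ?_)
  filter_upwards [Ioo_mem_nhdsLT (show (0:ℝ) < 1 by norm_num)] with r hr
  rw [gFun_series hr, Complex.ofReal_tsum]

lemma int_pi : ∫ x in (0:ℝ)..π, (log (sin x)) ^ 3 =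
    -(3 * π / 2) * zetaVal 3 - π ^ 3 / 4 * log 2 - π * log 2 ^ 3 := by
  have h1m : (1:ℝ) ∈ Icc (0:ℝ) 1 := by simp
  have i : ∀ p ≤ 3, IntervalIntegrable (fun x => gFun 1 x ^ p) volume 0 π := by
    intro p hp
    simpa using gFun_integrable hp (w := fun _ => 1) continuous_const (by intro x _; simp) h1m
  have iw : IntervalIntegrable (fun x : ℝ => gFun 1 x ^ 1 * ((x : ℂ) - π / 2) ^ 2) volume 0 π :=
    gFun_integrable (by norm_num) (by fun_prop) (fun x hx => w_bound hx) h1m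
  have iq : IntervalIntegrable (fun x : ℝ => ((x : ℂ) - π / 2) ^ 2) volume 0 π :=
    Continuous.intervalIntegrable (by fun_prop) _ _
  have vq : ∫ x in (0:ℝ)..π, ((x : ℂ) - π / 2) ^ 2 = (π : ℂ) ^ 3 / 12 := by
    have : ∫ x in (0:ℝ)..π, (x - π / 2) ^ 2 = π ^ 3 / 12 := by
      rw [intervalIntegral.integral_comp_sub_right (fun x => x ^ 2)]
      rw [integral_pow]
      push_cast
      ring
    have h2 := congrArg (fun t : ℝ => (t : ℂ)) this
    simp only [← intervalIntegral.integral_ofReal] at h2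
    push_cast at h2
    exact h2
  set l : ℂ := ((log 2 : ℝ) : ℂ) with hl
  have hH : ∫ x in (0:ℝ)..π, (gFun 1 x ^ 3 + 3 * (gFun 1 x ^ 1 * ((x : ℂ) - π / 2) ^ 2)
      - 3 * l * gFun 1 x ^ 2 - 3 * l * ((x : ℂ) - π / 2) ^ 2 + 3 * l ^ 2 * gFun 1 x ^ 1 - l ^ 3) =
     ((-(3 * π / 2) * zetaVal 3 - π ^ 3 / 4 * log 2 - π * log 2 ^ 3 : ℝ) : ℂ) := by
    have a1 := (i 3 (by norm_num)).add (iw.const_mul 3)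
    have a2 := a1.sub ((i 2 (by norm_num)).const_mul (3 * l))
    have a3 := a2.sub (iq.const_mul (3 * l))
    have a4 := a3.add ((i 1 (by norm_num)).const_mul (3 * l ^ 2))
    rw [intervalIntegral.integral_sub a4 intervalIntegrable_const,
      intervalIntegral.integral_add a3 ((i 1 (by norm_num)).const_mul (3 * l ^ 2)),
      intervalIntegral.integral_sub a2 (iq.const_mul (3 * l)),
      intervalIntegral.integral_sub a1 ((i 2 (by norm_num)).const_mul (3 * l)),
      intervalIntegral.integral_add (i 3 (by norm_num)) (iw.const_mul 3)]
    simp only [intervalIntegral.integral_const_mul, intervalIntegral.integral_const]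
    rw [gFun_one_mean (by norm_num) (by norm_num), gFun_one_mean (by norm_num) (by norm_num),
      gFun_one_mean (by norm_num) (by norm_num), gFun_one_weighted, vq, sub_zero, Complex.real_smul,
      hl]
    push_cast
    ring
  have iH : IntervalIntegrable (fun x : ℝ =>
      (gFun 1 x ^ 3 + 3 * (gFun 1 x ^ 1 * ((x : ℂ) - π / 2) ^ 2)
      - 3 * l * gFun 1 x ^ 2 - 3 * l * ((x : ℂ) - π / 2) ^ 2 + 3 * l ^ 2 * gFun 1 x ^ 1 - l ^ 3))
      volume 0 π :=
    ((((((i 3 (by norm_num)).add (iw.const_mul 3)).sub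
      ((i 2 (by norm_num)).const_mul (3 * l))).sub (iq.const_mul (3 * l))).add
      ((i 1 (by norm_num)).const_mul (3 * l ^ 2))).sub intervalIntegrable_const)
  have hre := Complex.reCLM.intervalIntegral_comp_comm iH
  rw [hH] at hre
  simp only [Complex.reCLM_apply, Complex.ofReal_re] at hre
  rw [← hre]
  apply intervalIntegral.integral_congr_ae
  filter_upwards [ae_Ioo] with x hx h
  rw [gFun_one (hx h), hl]
  set S := log (sin x)
  set m := log 2
  have : (((m + S : ℝ) : ℂ) + ((x - π / 2 : ℝ) : ℂ) * Complex.I) ^ 3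
      + 3 * ((((m + S : ℝ) : ℂ) + ((x - π / 2 : ℝ) : ℂ) * Complex.I) ^ 1 * ((x : ℂ) - π / 2) ^ 2)
      - 3 * (m : ℂ) * (((m + S : ℝ) : ℂ) + ((x - π / 2 : ℝ) : ℂ) * Complex.I) ^ 2
      - 3 * (m : ℂ) * ((x : ℂ) - π / 2) ^ 2
      + 3 * (m : ℂ) ^ 2 * (((m + S : ℝ) : ℂ) + ((x - π / 2 : ℝ) : ℂ) * Complex.I) ^ 1 - (m : ℂ) ^ 3
      = ((S ^ 3 : ℝ) : ℂ) + ((3 * (m + S) ^ 2 * (x - π / 2) - (x - π / 2) ^ 3 + 3 * (x - π / 2) ^ 3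
        - 6 * m * (m + S) * (x - π / 2) + 3 * m ^ 2 * (x - π / 2) : ℝ) : ℂ) * Complex.I := by
    push_cast
    linear_combination (3 * ((m:ℂ) + S) * ((x:ℂ) - π / 2) ^ 2 + ((x:ℂ) - π / 2) ^ 3 * Complex.I
      - 3 * (m:ℂ) * ((x:ℂ) - π / 2) ^ 2) * Complex.I_sq
  rw [this, Complex.add_re, Complex.ofReal_re, Complex.re_ofReal_mul, Complex.I_re, mul_zero,
    add_zero]

lemma log_sin_cube_integrable : IntervalIntegrable (fun x => (log (sin x)) ^ 3) volume 0 π := by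
  have h1m : (1:ℝ) ∈ Icc (0:ℝ) 1 := by simp
  refine (bound_integrable (12 ^ 3 * 10 * (2 / π) ^ (-(1/2) : ℝ))).mono_fun' ?_ ?_
  · exact Measurable.aestronglyMeasurable (by fun_prop)
  · rw [EventuallyLE, ae_restrict_iff' measurableSet_uIoc]
    filter_upwards [ae_Ioo] with x hx h
    have hx := hx h
    have hs : 0 < sin x := Real.sin_pos_of_mem_Ioo hx
    have hs1 : sin x ≤ 1 := Real.sin_le_one x
    have h4 := Real.abs_log_mul_self_rpow_lt (sin x) (1/6) hs hs1 (by norm_num)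
    have hpos : 0 < (sin x) ^ (1/6 : ℝ) := by positivity
    rw [abs_mul, abs_of_pos hpos] at h4
    have h6 : |log (sin x)| ≤ 6 * (sin x) ^ (-(1/6) : ℝ) := by
      rw [Real.rpow_neg hs.le, ← div_eq_mul_inv, le_div_iff₀ hpos]
      norm_num at h4 ⊢
      exact h4.le
    have h2 : ((sin x) ^ (-(1/6) : ℝ)) ^ 3 = (sin x) ^ (-(1/2) : ℝ) := by
      rw [← Real.rpow_natCast, ← Real.rpow_mul hs.le]; norm_num
    have h3 := sin_rpow_le hx
    have h7 : 0 ≤ (sin x) ^ (-(1/2) : ℝ) := by positivity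
    have h8 := pow_le_pow_left₀ (abs_nonneg _) h6 3
    rw [mul_pow, h2] at h8
    rw [norm_pow, Real.norm_eq_abs, mul_assoc]
    linarith

theorem stmt_12 :
    ∫ x in (0 : ℝ)..(π / 2), (Real.log (Real.sin x)) ^ 3
    = -(3 * π / 4) * zetaVal 3 - π ^ 3 / 8 * Real.log 2 - π / 2 * Real.log 2 ^ 3 := by
  have h := int_pi
  have hp := Real.pi_pos
  have i1 : IntervalIntegrable (fun x => (log (sin x)) ^ 3) volume 0 (π / 2) :=
    log_sin_cube_integrable.mono_set (by
      rw [uIcc_of_le (by linarith), uIcc_of_le hp.le]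
      exact Icc_subset_Icc_right (by linarith))
  have i2 : IntervalIntegrable (fun x => (log (sin x)) ^ 3) volume (π / 2) π :=
    log_sin_cube_integrable.mono_set (by
      rw [uIcc_of_le (by linarith), uIcc_of_le hp.le]
      exact Icc_subset_Icc_left (by linarith))
  rw [← intervalIntegral.integral_add_adjacent_intervals i1 i2] at h
  have h2 := intervalIntegral.integral_comp_sub_left (a := 0) (b := π / 2)
    (fun x => (log (sin x)) ^ 3) π
  simp only [Real.sin_pi_sub, sub_zero] at h2
  rw [show π - π / 2 = π / 2 by ring] at h2
  rw [← h2] at h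
  linarith
end
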